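/- arXiv:0711.4990 — 3 statements merged into one kernel-verified Lean document; each statement's English description precedes it below -/
import Mathlib

section
/- Every context-free language over a finite alphabet has either polynomial growth or exponential growth; no intermediate growth is possible. -/
open Computability

/-- The number of words of length `m` in the language `L`. -/
noncomputable def Language.growthCount {α : Type*} (L : Language α) (m : ℕ) : ℕ :=
  {w ∈ (L : Set (List α)) | w.length = m}.ncard

/-- `L` has polynomial growth: there is a polynomial `p` with `|L ∩ Σ^m| ≤ p(m)` for all `m`. -/
def Language.HasPolynomialGrowth {α : Type*} (L : Language α) : Prop :=
  ∃ p : Polynomial ℕ, ∀ m : ℕ, L.growthCount m ≤ p.eval m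

/-- `L` has exponential growth: for some real `r > 1`, `|L ∩ Σ^m| ≥ r^m` for infinitely many `m`. -/
def Language.HasExponentialGrowth {α : Type*} (L : Language α) : Prop :=
  ∃ r : ℝ, 1 < r ∧ {m : ℕ | r ^ m ≤ (L.growthCount m : ℝ)}.Infinite

namespace Language

variable {α : Type*}

/-- The number of words of length at most `m` in a language is polynomially bounded in `m`. -/
def HasPolynomialBalls (L : Language α) : Prop :=
  ∃ k : ℕ, ∀ m : ℕ, {w ∈ (L : Set (List α)) | w.length ≤ m}.ncard ≤ (m + 2) ^ k

lemma finite_ball [Finite α] (L : Language α) (m : ℕ) :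
    {w ∈ (L : Set (List α)) | w.length ≤ m}.Finite :=
  (List.finite_length_le α m).subset fun _ hw => hw.2

lemma finite_sphere [Finite α] (L : Language α) (m : ℕ) :
    {w ∈ (L : Set (List α)) | w.length = m}.Finite :=
  (L.finite_ball m).subset fun _ hw => ⟨hw.1, hw.2.le⟩

lemma HasPolynomialBalls.hasPolynomialGrowth [Finite α] {L : Language α}
    (h : L.HasPolynomialBalls) : L.HasPolynomialGrowth := by
  obtain ⟨k, hk⟩ := h
  refine ⟨(Polynomial.X + 2) ^ k, fun m => ?_⟩
  have h1 : L.growthCount m ≤ (m + 2) ^ k :=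
    (Set.ncard_le_ncard (fun _ hw => And.intro hw.1 (le_of_eq hw.2)) (L.finite_ball m)).trans
      (hk m)
  simpa using h1

lemma HasPolynomialBalls.mono [Finite α] {L M : Language α} (hM : M.HasPolynomialBalls)
    (h : ∀ w ∈ L, w ∈ M) : L.HasPolynomialBalls := by
  obtain ⟨k, hk⟩ := hM
  exact ⟨k, fun m =>
    (Set.ncard_le_ncard (fun w hw => And.intro (h w hw.1) hw.2) (M.finite_ball m)).trans (hk m)⟩

lemma hasPolynomialBalls_zero : (0 : Language α).HasPolynomialBalls := by
  refine ⟨0, fun m => ?_⟩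
  have : {w ∈ ((0 : Language α) : Set (List α)) | w.length ≤ m} = ∅ :=
    Set.eq_empty_of_forall_notMem fun w hw => Language.notMem_zero w hw.1
  rw [this]
  simp

lemma HasPolynomialBalls.add {L M : Language α} (hL : L.HasPolynomialBalls)
    (hM : M.HasPolynomialBalls) : (L + M).HasPolynomialBalls := by
  obtain ⟨k, hk⟩ := hL
  obtain ⟨l, hl⟩ := hM
  refine ⟨k + l + 1, fun m => ?_⟩
  have h : {w ∈ ((L + M : Language α) : Set (List α)) | w.length ≤ m} =
      {w ∈ (L : Set (List α)) | w.length ≤ m} ∪ {w ∈ (M : Set (List α)) | w.length ≤ m} := by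
    ext w
    exact or_and_right
  rw [h]
  refine (Set.ncard_union_le _ _).trans ((Nat.add_le_add (hk m) (hl m)).trans ?_)
  have h1 : (m + 2) ^ k ≤ (m + 2) ^ (k + l) := Nat.pow_le_pow_right (by omega) (by omega)
  have h2 : (m + 2) ^ l ≤ (m + 2) ^ (k + l) := Nat.pow_le_pow_right (by omega) (by omega)
  calc (m + 2) ^ k + (m + 2) ^ l ≤ (m + 2) ^ (k + l) * 2 := by omega
    _ ≤ (m + 2) ^ (k + l + 1) := Nat.mul_le_mul_left _ (by omega)

lemma HasPolynomialBalls.mul [Finite α] {L M : Language α} (hL : L.HasPolynomialBalls)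
    (hM : M.HasPolynomialBalls) : (L * M).HasPolynomialBalls := by
  obtain ⟨k, hk⟩ := hL
  obtain ⟨l, hl⟩ := hM
  refine ⟨k + l, fun m => ?_⟩
  have h : {w ∈ ((L * M : Language α) : Set (List α)) | w.length ≤ m} ⊆
      (fun p : List α × List α => p.1 ++ p.2) ''
        ({w ∈ (L : Set (List α)) | w.length ≤ m} ×ˢ {w ∈ (M : Set (List α)) | w.length ≤ m}) := by
    rintro _ ⟨⟨u, hu, v, hv, rfl⟩, hm⟩
    simp only [List.length_append] at hm
    exact ⟨(u, v), ⟨⟨hu, by dsimp only; omega⟩, ⟨hv, by dsimp only; omega⟩⟩, rfl⟩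
  have hfin := (L.finite_ball m).prod (M.finite_ball m)
  refine (Set.ncard_le_ncard h (hfin.image _)).trans ((Set.ncard_image_le hfin).trans ?_)
  rw [Set.ncard_prod, pow_add]
  exact Nat.mul_le_mul (hk m) (hl m)

lemma hasPolynomialBalls_of_length_injOn {L : Language α}
    (h : Set.InjOn List.length (L : Set (List α))) : L.HasPolynomialBalls := by
  refine ⟨1, fun m => ?_⟩
  have h1 := Set.ncard_le_ncard_of_injOn (t := Set.Iic m) List.length
    (s := {w ∈ (L : Set (List α)) | w.length ≤ m}) (fun w hw => hw.2)
    (h.mono fun w hw => hw.1) (Set.finite_Iic m)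
  have h2 : (Set.Iic m).ncard = m + 1 := by
    rw [← Finset.coe_Iic, Set.ncard_coe_finset, Nat.card_Iic]
  rw [pow_one]
  omega

lemma hasPolynomialBalls_singleton (w : List α) :
    HasPolynomialBalls ({w} : Set (List α)) :=
  hasPolynomialBalls_of_length_injOn (Set.injOn_singleton _ _)

lemma hasPolynomialBalls_biUnion [Finite α] {ι : Type*} (s : Finset ι) (f : ι → Language α)
    (h : ∀ i ∈ s, (f i).HasPolynomialBalls) :
    HasPolynomialBalls {w : List α | ∃ i ∈ s, w ∈ f i} := by
  classical
  induction s using Finset.induction_on with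
  | empty =>
    refine hasPolynomialBalls_zero.mono fun w hw => ?_
    obtain ⟨i, hi, -⟩ := hw
    exact absurd hi (Finset.notMem_empty i)
  | insert i s _ ih =>
    refine ((h i (Finset.mem_insert_self i s)).add
      (ih fun j hj => h j (Finset.mem_insert_of_mem hj))).mono fun w hw => ?_
    obtain ⟨j, hj, hw⟩ := hw
    obtain rfl | hj := Finset.mem_insert.1 hj
    · exact .inl hw
    · exact .inr ⟨j, hj, hw⟩

/-- If the growth function dominates `2 ^ n` along an arithmetic progression, then the growth is
exponential. -/
lemma hasExponentialGrowth_of_two_pow_le {L : Language α} {c d : ℕ} (hc : 0 < c)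
    (h : ∀ n, 2 ^ n ≤ L.growthCount (n * c + d)) : L.HasExponentialGrowth := by
  have hcd : (0 : ℝ) < ((c + d : ℕ) : ℝ) := by exact_mod_cast (by omega : 0 < c + d)
  set r : ℝ := (2 : ℝ) ^ (1 / ((c + d : ℕ) : ℝ)) with hr
  have hr1 : 1 < r := Real.one_lt_rpow (by norm_num) (by positivity)
  have hr2 : r ^ (c + d) = 2 := by
    rw [hr, ← Real.rpow_natCast, ← Real.rpow_mul (by norm_num), one_div_mul_cancel hcd.ne',
      Real.rpow_one]
  refine ⟨r, hr1, Set.infinite_of_injective_forall_mem (f := fun n : ℕ => (n + 1) * c + d)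
    (fun a b hab => ?_) fun n => ?_⟩
  · have : (a + 1) * c = (b + 1) * c := by simpa using hab
    have := Nat.eq_of_mul_eq_mul_right hc this
    omega
  · calc r ^ ((n + 1) * c + d) ≤ r ^ ((c + d) * (n + 1)) :=
          pow_le_pow_right₀ hr1.le (by nlinarith)
      _ = ((2 ^ (n + 1) : ℕ) : ℝ) := by rw [pow_mul, hr2]; norm_cast
      _ ≤ _ := by exact_mod_cast h (n + 1)

lemma growthCount_le_of_sandwich [Finite α] {L M : Language α} (s t : List α)
    (h : ∀ w ∈ L, s ++ w ++ t ∈ M) (m : ℕ) :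
    L.growthCount m ≤ M.growthCount (m + (s.length + t.length)) := by
  refine Set.ncard_le_ncard_of_injOn (fun w => s ++ w ++ t) (fun w hw => ⟨h w hw.1, ?_⟩)
    (fun a _ b _ hab => by simpa using hab) (M.finite_sphere _)
  have := hw.2
  simp only [List.length_append]
  omega

lemma two_mul_growthCount_le [Finite α] {L : Language α} {u v u' v' : List α}
    (hu : u.length = u'.length) (hv : v.length = v'.length) (hne : u ≠ u' ∨ v ≠ v')
    (h : ∀ w ∈ L, u ++ w ++ v ∈ L) (h' : ∀ w ∈ L, u' ++ w ++ v' ∈ L) (m : ℕ) :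
    2 * L.growthCount m ≤ L.growthCount (m + (u.length + v.length)) := by
  set S := {w ∈ (L : Set (List α)) | w.length = m} with hS
  have hSf : S.Finite := L.finite_sphere m
  have hinj : ∀ a b : List α, Function.Injective fun w => a ++ w ++ b :=
    fun a b x y hxy => by simpa using hxy
  have hdisj : Disjoint ((fun w => u ++ w ++ v) '' S) ((fun w => u' ++ w ++ v') '' S) := by
    rw [Set.disjoint_left]
    rintro _ ⟨a, ha, rfl⟩ ⟨b, hb, hab⟩
    have hlen : a.length = b.length := ha.2.trans hb.2.symm
    obtain ⟨h1, h2⟩ := List.append_inj hab (by simp [hu, hlen])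
    obtain ⟨h3, -⟩ := List.append_inj h1 hu.symm
    exact hne.elim (fun h => h h3.symm) (fun h => h h2.symm)
  have hsub : (fun w => u ++ w ++ v) '' S ∪ (fun w => u' ++ w ++ v') '' S ⊆
      {w ∈ (L : Set (List α)) | w.length = m + (u.length + v.length)} := by
    rintro _ (⟨w, hw, rfl⟩ | ⟨w, hw, rfl⟩)
    · refine ⟨h w hw.1, ?_⟩
      have := hw.2
      simp only [List.length_append]
      omega
    · refine ⟨h' w hw.1, ?_⟩
      have := hw.2
      simp only [List.length_append]
      omega
  have hcard := Set.ncard_le_ncard hsub (L.finite_sphere _)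
  rw [Set.ncard_union_eq hdisj (hSf.image _) (hSf.image _),
    Set.ncard_image_of_injective _ (hinj u v), Set.ncard_image_of_injective _ (hinj u' v')] at hcard
  rw [two_mul]
  exact hcard

end Language

namespace ContextFreeGrammar

variable {T : Type*} {g : ContextFreeGrammar T}

/-- `g.DerivesWithin P β w`: the string `β` derives the terminal word `w` by a derivation which
only rewrites nonterminals from `P`. -/
inductive DerivesWithin (g : ContextFreeGrammar T) (P : Set g.NT) :
    List (Symbol T g.NT) → List T → Prop
  | nil : DerivesWithin g P [] []
  | terminal (a : T) {β : List (Symbol T g.NT)} {w : List T} (h : DerivesWithin g P β w) :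
      DerivesWithin g P (Symbol.terminal a :: β) (a :: w)
  | nonterminal {r : ContextFreeRule T g.NT} {β : List (Symbol T g.NT)} {u v : List T}
      (hr : r ∈ g.rules) (hP : r.input ∈ P) (hu : DerivesWithin g P r.output u)
      (hv : DerivesWithin g P β v) :
      DerivesWithin g P (Symbol.nonterminal r.input :: β) (u ++ v)

lemma Derives.append {β γ β' γ' : List (Symbol T g.NT)} (h : g.Derives β β')
    (h' : g.Derives γ γ') : g.Derives (β ++ γ) (β' ++ γ') :=
  (h.append_right γ).trans (h'.append_left β')

lemma derives_of_mem_rules {r : ContextFreeRule T g.NT} (hr : r ∈ g.rules) :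
    g.Derives [Symbol.nonterminal r.input] r.output :=
  Produces.single ⟨r, hr, ContextFreeRule.Rewrites.input_output⟩

namespace DerivesWithin

variable {P : Set g.NT} {β γ : List (Symbol T g.NT)} {u v w : List T}

lemma derives (h : g.DerivesWithin P β w) : g.Derives β (w.map Symbol.terminal) := by
  induction h with
  | nil => exact .refl _
  | terminal a _ ih => exact ih.append_left [Symbol.terminal a]
  | nonterminal hr _ _ _ ihu ihv =>
    rw [List.map_append]
    exact ((derives_of_mem_rules hr).trans ihu).append ihv

lemma append (hu : g.DerivesWithin P β u) (hv : g.DerivesWithin P γ v) :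
    g.DerivesWithin P (β ++ γ) (u ++ v) := by
  induction hu with
  | nil => exact hv
  | terminal a _ ih => exact .terminal a ih
  | nonterminal hr hP h _ _ ihv =>
    rw [List.append_assoc]
    exact .nonterminal hr hP h ihv

lemma exists_of_append (h : g.DerivesWithin P (β ++ γ) w) :
    ∃ u v, w = u ++ v ∧ g.DerivesWithin P β u ∧ g.DerivesWithin P γ v := by
  induction β generalizing w with
  | nil => exact ⟨[], w, rfl, .nil, h⟩
  | cons s β ih =>
    cases h with
    | terminal a h =>
      obtain ⟨u, v, rfl, hu, hv⟩ := ih h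
      exact ⟨a :: u, v, rfl, .terminal a hu, hv⟩
    | nonterminal hr hP hx h =>
      obtain ⟨u, v, rfl, hu, hv⟩ := ih h
      exact ⟨_ ++ u, v, (List.append_assoc ..).symm, .nonterminal hr hP hx hu, hv⟩

lemma of_terminals (w : List T) : g.DerivesWithin P (w.map Symbol.terminal) w := by
  induction w with
  | nil => exact .nil
  | cons a w ih => exact .terminal a ih

lemma of_produces (h : g.Produces β γ) (hw : g.DerivesWithin Set.univ γ w) :
    g.DerivesWithin Set.univ β w := by
  obtain ⟨r, hr, hrw⟩ := h
  obtain ⟨p, q, rfl, rfl⟩ := hrw.exists_parts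
  obtain ⟨x, v, rfl, hx, hv⟩ := hw.exists_of_append
  obtain ⟨p', u, rfl, hp, hu⟩ := hx.exists_of_append
  rw [List.append_assoc, List.append_assoc]
  exact hp.append (.nonterminal hr trivial hu hv)

lemma of_derives (h : g.Derives β (w.map Symbol.terminal)) :
    g.DerivesWithin Set.univ β w := by
  induction h using Relation.ReflTransGen.head_induction_on with
  | refl => exact of_terminals w
  | head h _ ih => exact of_produces h ih

/-- Either a nonterminal `A` is not rewritten in a derivation, or some rewriting of `A` is
followed by no further rewriting of `A` in its subtree. -/
lemma diff_or_exists (A : g.NT) (h : g.DerivesWithin P β w) :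
    g.DerivesWithin (P \ {A}) β w ∨
      ∃ (x z y : List T) (r : ContextFreeRule T g.NT), w = x ++ z ++ y ∧
        g.Derives β
          (x.map Symbol.terminal ++ [Symbol.nonterminal A] ++ y.map Symbol.terminal) ∧
        r ∈ g.rules ∧ r.input = A ∧ g.DerivesWithin (P \ {A}) r.output z := by
  induction h with
  | nil => exact .inl .nil
  | terminal a h ih =>
    obtain ih | ⟨x, z, y, r, rfl, hd, hr⟩ := ih
    · exact .inl (.terminal a ih)
    · exact .inr ⟨a :: x, z, y, r, rfl, hd.append_left [Symbol.terminal a], hr⟩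
  | @nonterminal r β u v hr hP hu hv ihu ihv =>
    obtain ihv | ⟨x, z, y, r', rfl, hd, hr'⟩ := ihv
    · obtain ihu | ⟨x, z, y, r', rfl, hd, hr'⟩ := ihu
      · by_cases hA : r.input = A
        · refine .inr ⟨[], u, v, r, rfl, ?_, hr, hA, ihu⟩
          rw [hA]
          exact hv.derives.append_left [Symbol.nonterminal A]
        · exact .inl (.nonterminal hr ⟨hP, hA⟩ ihu ihv)
      · refine .inr ⟨x, z, y ++ v, r', by simp, ?_, hr'⟩
        simpa using ((derives_of_mem_rules hr).trans hd).append hv.derives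
    · refine .inr ⟨u ++ x, z, y, r', by simp, ?_, hr'⟩
      simpa using ((derives_of_mem_rules hr).trans hu.derives).append hd

end DerivesWithin

/-- Nonterminals which occur in some derivation of a terminal word from the initial symbol. -/
def useful (g : ContextFreeGrammar T) : Set g.NT :=
  {A | (∃ s t : List T, g.Derives [Symbol.nonterminal g.initial]
      (s.map Symbol.terminal ++ [Symbol.nonterminal A] ++ t.map Symbol.terminal)) ∧
    ∃ z : List T, g.Derives [Symbol.nonterminal A] (z.map Symbol.terminal)}

lemma DerivesWithin.useful {P : Set g.NT} {β : List (Symbol T g.NT)} {w : List T}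
    (h : g.DerivesWithin P β w) (s t : List T)
    (hst : g.Derives [Symbol.nonterminal g.initial]
      (s.map Symbol.terminal ++ β ++ t.map Symbol.terminal)) :
    g.DerivesWithin
      (g.useful ∩ ContextFreeRule.input '' (g.rules : Set (ContextFreeRule T g.NT))) β w := by
  induction h generalizing s t with
  | nil => exact .nil
  | terminal a _ ih =>
    refine .terminal a (ih (s ++ [a]) t ?_)
    simpa using hst
  | @nonterminal r β u v hr _ hu hv ihu ihv =>
    have hru := (derives_of_mem_rules hr).trans hu.derives
    have hst' : g.Derives [Symbol.nonterminal g.initial]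
        (s.map Symbol.terminal ++ [Symbol.nonterminal r.input] ++
          (v ++ t).map Symbol.terminal) := by
      refine hst.trans ?_
      have := (hv.derives.append_left
        (s.map Symbol.terminal ++ [Symbol.nonterminal r.input])).append_right
          (t.map Symbol.terminal)
      simpa using this
    refine .nonterminal hr ⟨⟨⟨s, v ++ t, hst'⟩, u, hru⟩, r, hr, rfl⟩ (ihu s (v ++ t) ?_)
      (ihv (s ++ u) t ?_)
    · exact hst'.trans (((derives_of_mem_rules hr).append_left _).append_right _)
    · refine hst.trans ?_
      have := (hru.append_left (s.map Symbol.terminal)).append_right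
        (β ++ t.map Symbol.terminal)
      simpa using this

/-- The nonterminal `A` derives `x A y`. -/
def DerivesContext (g : ContextFreeGrammar T) (A : g.NT) (x y : List T) : Prop :=
  g.Derives [Symbol.nonterminal A]
    (x.map Symbol.terminal ++ [Symbol.nonterminal A] ++ y.map Symbol.terminal)

lemma derives_sandwich {β : List (Symbol T g.NT)} {A : g.NT} {x y w : List T}
    (h : g.Derives β
      (x.map Symbol.terminal ++ [Symbol.nonterminal A] ++ y.map Symbol.terminal))
    (hw : g.Derives [Symbol.nonterminal A] (w.map Symbol.terminal)) :
    g.Derives β ((x ++ w ++ y).map Symbol.terminal) := by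
  rw [List.map_append, List.map_append]
  exact h.trans ((hw.append_left _).append_right _)

lemma DerivesContext.comp {A : g.NT} {x y x' y' : List T} (h : g.DerivesContext A x y)
    (h' : g.DerivesContext A x' y') : g.DerivesContext A (x ++ x') (y' ++ y) := by
  refine Derives.trans h ?_
  have := (Derives.append_left h' (x.map Symbol.terminal)).append_right (y.map Symbol.terminal)
  simpa using this

theorem hasExponentialGrowth_of_derivesContext [Finite T] {A : g.NT} (hA : A ∈ g.useful)
    {x y x' y' : List T} (h : g.DerivesContext A x y) (h' : g.DerivesContext A x' y')
    (hne : (x.length = x'.length ∧ x ≠ x') ∨ (y.length = y'.length ∧ y ≠ y')) :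
    g.language.HasExponentialGrowth := by
  obtain ⟨⟨s, t, hst⟩, z, hz⟩ := hA
  set M : Language T := {w : List T | g.Derives [Symbol.nonterminal A] (w.map Symbol.terminal)}
  have hdouble := Language.two_mul_growthCount_le (L := M)
    (u := x ++ x') (v := y' ++ y) (u' := x' ++ x) (v' := y ++ y')
    (by simp [add_comm]) (by simp [add_comm])
    (hne.imp (fun h heq => h.2 (List.append_inj heq h.1).1)
      (fun h heq => h.2 (List.append_inj heq h.1.symm).1.symm))
    (fun w hw => derives_sandwich (h.comp h') hw) (fun w hw => derives_sandwich (h'.comp h) hw)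
  set c := (x ++ x').length + (y' ++ y).length with hc
  have hc0 : 0 < c := by
    rw [Nat.pos_iff_ne_zero]
    intro h0
    simp only [hc, List.length_append, Nat.add_eq_zero_iff, List.length_eq_zero_iff] at h0
    obtain ⟨⟨rfl, rfl⟩, rfl, rfl⟩ := h0
    simp at hne
  have hpow : ∀ n, 2 ^ n ≤ M.growthCount (n * c + z.length) := by
    intro n
    induction n with
    | zero =>
      rw [pow_zero, Nat.one_le_iff_ne_zero]
      exact Set.ncard_ne_zero_of_mem (a := z) ⟨hz, by simp⟩ (M.finite_sphere _)
    | succ n ih =>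
      have h1 := hdouble (n * c + z.length)
      have h2 : n * c + z.length + c = (n + 1) * c + z.length := by ring
      rw [h2] at h1
      rw [pow_succ]
      omega
  refine Language.hasExponentialGrowth_of_two_pow_le (c := c)
    (d := z.length + (s.length + t.length)) hc0 fun n => (hpow n).trans ?_
  rw [← add_assoc]
  exact Language.growthCount_le_of_sandwich s t (fun w hw => derives_sandwich hst hw) _

/-- The words derived from `β` by rewriting only nonterminals in `P`. -/
def languageWithin (g : ContextFreeGrammar T) (P : Set g.NT) (β : List (Symbol T g.NT)) :
    Language T :=
  {w | g.DerivesWithin P β w}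

theorem hasPolynomialBalls_languageWithin [Finite T] {P : Set g.NT} (hP : P.Finite)
    (hleft : ∀ A ∈ P, Set.InjOn List.length {x : List T | ∃ y, g.DerivesContext A x y})
    (hright : ∀ A ∈ P, Set.InjOn List.length {y : List T | ∃ x, g.DerivesContext A x y})
    (β : List (Symbol T g.NT)) : (g.languageWithin P β).HasPolynomialBalls := by
  induction hn : P.ncard using Nat.strong_induction_on generalizing P β with
  | _ n ih =>
  have hsingle : ∀ A ∈ P, (g.languageWithin P [Symbol.nonterminal A]).HasPolynomialBalls := by
    intro A hA
    have hinner := Language.hasPolynomialBalls_biUnion g.rules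
      (fun r => g.languageWithin (P \ {A}) r.output) fun r _ =>
        ih _ (hn ▸ Set.ncard_sdiff_singleton_lt_of_mem hA hP) hP.sdiff
          (fun B hB => hleft B hB.1) (fun B hB => hright B hB.1) r.output rfl
    refine (((Language.hasPolynomialBalls_of_length_injOn (hleft A hA)).mul hinner).mul
      (Language.hasPolynomialBalls_of_length_injOn (hright A hA))).mono fun w hw => ?_
    obtain h | ⟨x, z, y, r, rfl, hd, hr, -, hz⟩ := DerivesWithin.diff_or_exists A hw
    · cases h with
      | nonterminal _ h _ _ => exact absurd rfl h.2
    · exact Language.append_mem_mul (Language.append_mem_mul ⟨y, hd⟩ ⟨r, hr, hz⟩) ⟨x, hd⟩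
  induction β with
  | nil =>
    refine (Language.hasPolynomialBalls_singleton []).mono fun w hw => ?_
    cases hw
    rfl
  | cons s β ihβ =>
    cases s with
    | terminal a =>
      refine ((Language.hasPolynomialBalls_singleton [a]).mul ihβ).mono fun w hw => ?_
      cases hw with
      | terminal _ h => exact Language.append_mem_mul (a := [a]) rfl h
    | nonterminal A =>
      by_cases hA : A ∈ P
      · refine ((hsingle A hA).mul ihβ).mono fun w hw => ?_
        cases hw with
        | nonterminal hr hP hu hv =>
          refine Language.append_mem_mul ?_ hv
          have := DerivesWithin.nonterminal hr hP hu .nil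
          rwa [List.append_nil] at this
      · refine Language.hasPolynomialBalls_zero.mono fun w hw => ?_
        cases hw with
        | nonterminal _ h _ _ => exact absurd h hA

end ContextFreeGrammar

/-- Every context-free language over a finite alphabet has either polynomial growth or
exponential growth; no intermediate growth is possible. -/
theorem contextFree_polynomialGrowth_or_exponentialGrowth {α : Type} [Fintype α]
    (L : Language α) (hL : L.IsContextFree) :
    L.HasPolynomialGrowth ∨ L.HasExponentialGrowth := by
  obtain ⟨g, rfl⟩ := hL
  by_contra hcon
  rw [not_or] at hcon
  obtain ⟨hpoly, hexp⟩ := hcon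
  refine hpoly (Language.HasPolynomialBalls.hasPolynomialGrowth ?_)
  refine (ContextFreeGrammar.hasPolynomialBalls_languageWithin
    (P := g.useful ∩ ContextFreeRule.input '' (g.rules : Set (ContextFreeRule α g.NT)))
    ((g.rules.finite_toSet.image _).subset Set.inter_subset_right) ?_ ?_
    [Symbol.nonterminal g.initial]).mono fun w hw =>
      (ContextFreeGrammar.DerivesWithin.of_derives hw).useful [] [] (.refl _)
  · rintro A ⟨hA, -⟩ x ⟨y, hxy⟩ x' ⟨y', hxy'⟩ hlen
    by_contra hne
    exact hexp (ContextFreeGrammar.hasExponentialGrowth_of_derivesContext hA hxy hxy'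
      (.inl ⟨hlen, hne⟩))
  · rintro A ⟨hA, -⟩ y ⟨x, hxy⟩ y' ⟨x', hxy'⟩ hlen
    by_contra hne
    exact hexp (ContextFreeGrammar.hasExponentialGrowth_of_derivesContext hA hxy hxy'
      (.inr ⟨hlen, hne⟩))
end

section
/- Let M = (Q, Σ, δ, q₀, F) be an NFA in which every state is accessible and co-accessible. If for every state q ∈ Q the language L_q is commutative, then L(M) is bounded. -/
open Computability

/-- `L` is bounded: `L ⊆ w₁* w₂* ⋯ w_k*` for some finitely many words `w₁, …, w_k`. -/
def Language.IsBounded {α : Type*} (L : Language α) : Prop :=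
  ∃ (k : ℕ) (w : Fin k → List α),
    L ≤ (List.ofFn fun i => ({w i} : Language α)∗).prod

/-- `L` is commutative: `L ⊆ u*` for some word `u`. -/
def Language.IsCommutativeLang {α : Type*} (L : Language α) : Prop :=
  ∃ u : List α, L ≤ ({u} : Language α)∗

/-- The state `q` of the NFA `M` is accessible: it is reachable from the start by some word. -/
def NFA.Accessible {α σ : Type*} (M : NFA α σ) (q : σ) : Prop :=
  ∃ w : List α, q ∈ M.eval w

/-- The state `q` is co-accessible: some accepting state is reachable from `q` by some word. -/
def NFA.CoAccessible {α σ : Type*} (M : NFA α σ) (q : σ) : Prop :=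
  ∃ w : List α, (M.evalFrom {q} w ∩ M.accept).Nonempty

/-- `L_q`: the language of words that can take `M` from state `q` back to state `q`. -/
def NFA.loopLang {α σ : Type*} (M : NFA α σ) (q : σ) : Language α :=
  {w | q ∈ M.evalFrom {q} w}

namespace Language

variable {α : Type*}

theorem isBounded_iff_exists_list {L : Language α} :
    L.IsBounded ↔ ∃ l : List (List α), L ≤ (l.map fun w => ({w} : Language α)∗).prod := by
  constructor
  · rintro ⟨k, w, h⟩
    exact ⟨List.ofFn w, by simpa [List.map_ofFn, Function.comp_def] using h⟩
  · rintro ⟨l, h⟩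
    refine ⟨l.length, l.get, ?_⟩
    rwa [← List.ofFn_get l, List.map_ofFn] at h

theorem IsBounded.mono {L K : Language α} (hK : K.IsBounded) (h : L ≤ K) : L.IsBounded := by
  obtain ⟨k, w, hw⟩ := hK
  exact ⟨k, w, h.trans hw⟩

theorem one_le_prod_map_kstar (l : List (List α)) :
    (1 : Language α) ≤ (l.map fun w => ({w} : Language α)∗).prod := by
  induction l with
  | nil => simp
  | cons w l ih =>
    rw [List.map_cons, List.prod_cons]
    exact one_le_mul one_le_kstar ih

theorem IsBounded.mul {L K : Language α} (hL : L.IsBounded) (hK : K.IsBounded) :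
    (L * K).IsBounded := by
  rw [isBounded_iff_exists_list] at *
  obtain ⟨l, hl⟩ := hL
  obtain ⟨m, hm⟩ := hK
  refine ⟨l ++ m, ?_⟩
  rw [List.map_append, List.prod_append]
  exact mul_le_mul' hl hm

theorem IsBounded.sup {L K : Language α} (hL : L.IsBounded) (hK : K.IsBounded) :
    (L ⊔ K).IsBounded := by
  rw [isBounded_iff_exists_list] at *
  obtain ⟨l, hl⟩ := hL
  obtain ⟨m, hm⟩ := hK
  refine ⟨l ++ m, ?_⟩
  rw [List.map_append, List.prod_append]
  exact sup_le (hl.trans (le_mul_of_one_le_right' (one_le_prod_map_kstar m)))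
    (hm.trans (le_mul_of_one_le_left' (one_le_prod_map_kstar l)))

theorem isBounded_one : (1 : Language α).IsBounded :=
  isBounded_iff_exists_list.2 ⟨[], one_le_prod_map_kstar []⟩

theorem IsCommutativeLang.isBounded {L : Language α} (hL : L.IsCommutativeLang) :
    L.IsBounded := by
  obtain ⟨u, hu⟩ := hL
  exact isBounded_iff_exists_list.2 ⟨[u], by simpa using hu⟩

theorem isBounded_singleton (w : List α) : ({w} : Language α).IsBounded :=
  IsCommutativeLang.isBounded ⟨w, le_kstar⟩

theorem IsBounded.iSup {ι : Type*} [Finite ι] {L : ι → Language α}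
    (hL : ∀ i, (L i).IsBounded) : (⨆ i, L i).IsBounded := by
  have := Fintype.ofFinite ι
  rw [← Finset.sup_univ_eq_iSup]
  exact Finset.sup_induction (isBounded_one.mono bot_le) (fun _ h _ h' => h.sup h')
    fun i _ => hL i

end Language

namespace NFA

variable {α σ : Type*} {M : NFA α σ}

/-- `M.IsTrace S p w`: the word `w` labels a path of `M` starting at `p` whose later states
all lie in `S`. -/
inductive IsTrace (M : NFA α σ) (S : Set σ) : σ → List α → Prop
  | nil (p : σ) : IsTrace M S p []
  | cons {p q : σ} {a : α} {w : List α} (hstep : q ∈ M.step p a) (hq : q ∈ S)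
      (hw : IsTrace M S q w) : IsTrace M S p (a :: w)

theorem isTrace_univ_of_mem_evalFrom {p q : σ} {w : List α} (h : q ∈ M.evalFrom {p} w) :
    M.IsTrace Set.univ p w := by
  induction w generalizing p with
  | nil => exact .nil p
  | cons a w ih =>
    rw [evalFrom_cons, stepSet_singleton, mem_evalFrom_iff_exists] at h
    obtain ⟨t, ht, hq⟩ := h
    exact .cons ht (Set.mem_univ t) (ih hq)

theorem IsTrace.avoid_or_exists_append {S : Set σ} {p : σ} {w : List α}
    (h : M.IsTrace S p w) (r : σ) :
    M.IsTrace (S \ {r}) p w ∨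
      ∃ x y, x ++ y = w ∧ r ∈ M.evalFrom {p} x ∧ M.IsTrace (S \ {r}) r y := by
  induction h with
  | nil p => exact .inl (.nil p)
  | @cons p q a w hstep hq hw ih =>
    rcases ih with ih | ⟨x, y, rfl, hx, hy⟩
    · by_cases hqr : q = r
      · subst hqr
        exact .inr ⟨[a], w, rfl, by simpa using hstep, ih⟩
      · exact .inl (.cons hstep ⟨hq, hqr⟩ ih)
    · refine .inr ⟨a :: x, y, rfl, ?_, hy⟩
      rw [evalFrom_cons, stepSet_singleton, mem_evalFrom_iff_exists]
      exact ⟨q, hstep, hx⟩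

theorem IsTrace.exists_loop_append {S : Set σ} {p : σ} {w : List α} (h : M.IsTrace S p w) :
    ∃ x y, x ++ y = w ∧ x ∈ M.loopLang p ∧ M.IsTrace (S \ {p}) p y := by
  rcases h.avoid_or_exists_append p with h | h
  · exact ⟨[], w, rfl, rfl, h⟩
  · exact h

theorem isBounded_setOf_isTrace [Finite α] [Finite σ]
    (hM : ∀ q, (M.loopLang q).IsBounded) (S : Set σ) (p : σ) :
    Language.IsBounded {w | M.IsTrace S p w} := by
  induction S using WellFoundedLT.induction generalizing p with
  | ind S ih =>
    have hS (q : S) : Language.IsBounded {w | M.IsTrace (S \ {q.1}) q w} :=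
      ih _ (Set.sdiff_singleton_ssubset.2 q.2) q
    refine (Language.isBounded_one.sup (Language.IsBounded.iSup fun a : α =>
      Language.IsBounded.iSup fun q : S =>
        (Language.isBounded_singleton [a]).mul ((hM q).mul (hS q)))).mono ?_
    rintro w (_ | @⟨_, q, a, w, hstep, hq, hw⟩)
    · exact Or.inl rfl
    · obtain ⟨x, y, rfl, hx, hy⟩ := hw.exists_loop_append
      refine Or.inr (Language.mem_iSup.2 ⟨a, Language.mem_iSup.2 ⟨⟨q, hq⟩, ?_⟩⟩)
      exact Language.append_mem_mul (a := [a]) rfl (Language.append_mem_mul hx hy)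

end NFA

/-- If every state of the NFA `M` (with start state `q₀`) is accessible and co-accessible
and every language `L_q` is commutative, then `L(M)` is bounded. -/
theorem isBounded_of_loopLang_isCommutative {α σ : Type*} [Fintype α] [Fintype σ]
    (M : NFA α σ) (q₀ : σ) (hstart : M.start = {q₀})
    (hacc : ∀ q : σ, M.Accessible q) (hcoacc : ∀ q : σ, M.CoAccessible q)
    (hcomm : ∀ q : σ, (M.loopLang q).IsCommutativeLang) :
    M.accepts.IsBounded := by
  refine (NFA.isBounded_setOf_isTrace (fun q => (hcomm q).isBounded) Set.univ q₀).mono ?_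
  rintro w ⟨q, -, hq⟩
  rw [NFA.eval, hstart] at hq
  exact NFA.isTrace_univ_of_mem_evalFrom hq
end

section
/- Let M be a DFA such that L(M) is infinite and has polynomial growth. Then there exists an integer d ≥ 1 such that the growth of L(M) is Θ(m^{d-1}): there are constants c₁, c₂ > 0 with |L(M) ∩ Σ^m| ≤ c₂·m^{d-1} for all m ≥ 1, and |L(M) ∩ Σ^m| ≥ c₁·m^{d-1} for infinitely many m. -/
open Computability

open Filter in
/-- No polynomial with natural coefficients dominates the powers of two along an arithmetic
progression of arguments. -/
theorem Polynomial.exists_eval_lt_two_pow (p : Polynomial ℕ) (a k : ℕ) :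
    ∃ n : ℕ, p.eval (a + n * k) < 2 ^ n := by
  by_contra! h
  set P : Polynomial ℝ := (p.comp (C a + C (2 * k) * X)).map (Nat.castRingHom ℝ) with hP
  have heval (n : ℕ) : P.eval (n : ℝ) = ((p.eval (a + (2 * n) * k) : ℕ) : ℝ) := by
    have h1 : (n : ℝ) = Nat.castRingHom ℝ n := rfl
    rw [hP, h1, eval_map_apply]
    simp only [eval_comp, eval_add, eval_mul, eval_X, eq_natCast]
    congr 2
    simp only [eval_natCast, Nat.cast_id]
    ring
  have ht := (Polynomial.tendsto_div_exp_atTop P).comp (tendsto_natCast_atTop_atTop (R := ℝ))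
  obtain ⟨n, hn⟩ := (ht.eventually (gt_mem_nhds (show (0 : ℝ) < 1 by norm_num))).exists
  simp only [Function.comp_apply] at hn
  rw [div_lt_one (Real.exp_pos _), heval] at hn
  have h2 : ((2 : ℝ) ^ (2 * n)) ≤ ((p.eval (a + (2 * n) * k) : ℕ) : ℝ) := by
    exact_mod_cast h (2 * n)
  have h3 : Real.exp n ≤ (2 : ℝ) ^ (2 * n) := by
    rw [pow_mul, ← Real.exp_one_pow]
    gcongr
    linarith [Real.exp_one_lt_d9]
  linarith

/-- A sequence of natural numbers has an exact order if it is eventually zero, or if for some `d`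
it is `O(m ^ d)` and at least a positive multiple of `m ^ d` along an arithmetic progression. -/
def HasExactOrder (f : ℕ → ℕ) : Prop :=
  (∃ N, ∀ m, N ≤ m → f m = 0) ∨
    ∃ d C r L : ℕ, 0 < L ∧ (∀ m, f m ≤ C * (m + 1) ^ d) ∧
      ∀ n, (n + 1) ^ d ≤ C * f (r + n * L)

namespace HasExactOrder

theorem zero : HasExactOrder 0 := Or.inl ⟨0, fun _ _ => rfl⟩

theorem exists_bound_of_eventually_zero {f : ℕ → ℕ} {N : ℕ} (hf : ∀ m, N ≤ m → f m = 0) :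
    ∃ B, ∀ m, f m ≤ B := by
  refine ⟨∑ i ∈ Finset.range N, f i, fun m => ?_⟩
  rcases lt_or_ge m N with h | h
  · exact Finset.single_le_sum (f := f) (fun _ _ => Nat.zero_le _) (Finset.mem_range.2 h)
  · simp [hf m h]

/-- Adding a sequence of smaller or equal order does not affect having an exact order. -/
theorem add_of_le {f g : ℕ → ℕ} {d B C r L : ℕ} (hL : 0 < L)
    (hf : ∀ m, f m ≤ B * (m + 1) ^ d) (hg : ∀ m, g m ≤ C * (m + 1) ^ d)
    (hg' : ∀ n, (n + 1) ^ d ≤ C * g (r + n * L)) : HasExactOrder (f + g) := by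
  refine Or.inr ⟨d, B + C, r, L, hL, fun m => ?_, fun n => ?_⟩
  · rw [Pi.add_apply, add_mul]
    exact add_le_add (hf m) (hg m)
  · refine (hg' n).trans (Nat.mul_le_mul (Nat.le_add_left _ _) ?_)
    simp

theorem add {f g : ℕ → ℕ} (hf : HasExactOrder f) (hg : HasExactOrder g) :
    HasExactOrder (f + g) := by
  have hpow (m : ℕ) {a b : ℕ} (h : a ≤ b) : (m + 1) ^ a ≤ (m + 1) ^ b :=
    Nat.pow_le_pow_right (Nat.succ_pos m) h
  rcases hf with ⟨N, hf⟩ | ⟨d, B, r, L, hL, hf, hf'⟩ <;>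
    rcases hg with ⟨N', hg⟩ | ⟨d', C, r', L', hL', hg, hg'⟩
  · refine Or.inl ⟨max N N', fun m hm => ?_⟩
    simp [hf m (le_trans (le_max_left _ _) hm), hg m (le_trans (le_max_right _ _) hm)]
  · obtain ⟨B, hB⟩ := exists_bound_of_eventually_zero hf
    exact add_of_le hL' (fun m => (hB m).trans (Nat.le_mul_of_pos_right _ (by positivity))) hg hg'
  · obtain ⟨B, hB⟩ := exists_bound_of_eventually_zero hg
    rw [add_comm]
    exact add_of_le hL (fun m => (hB m).trans (Nat.le_mul_of_pos_right _ (by positivity))) hf hf'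
  · rcases le_total d d' with h | h
    · exact add_of_le hL' (fun m => (hf m).trans (Nat.mul_le_mul_left _ (hpow m h))) hg hg'
    · rw [add_comm]
      exact add_of_le hL (fun m => (hg m).trans (Nat.mul_le_mul_left _ (hpow m h))) hf hf'

theorem sum {ι : Type*} (s : Finset ι) (f : ι → ℕ → ℕ) (hf : ∀ i ∈ s, HasExactOrder (f i)) :
    HasExactOrder (∑ i ∈ s, f i) :=
  Finset.sum_induction f HasExactOrder (fun _ _ => add) zero hf

theorem of_succ {f g : ℕ → ℕ} (hf : HasExactOrder f) (h : ∀ m, g (m + 1) = f m) :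
    HasExactOrder g := by
  rcases hf with ⟨N, hf⟩ | ⟨d, C, r, L, hL, hf, hf'⟩
  · refine Or.inl ⟨N + 1, fun m hm => ?_⟩
    obtain ⟨m, rfl⟩ := Nat.exists_eq_succ_of_ne_zero (by omega : m ≠ 0)
    exact (h m).trans (hf m (by omega))
  · refine Or.inr ⟨d, C + g 0, r + 1, L, hL, fun m => ?_, fun n => ?_⟩
    · rcases m with _ | m
      · simp
      · rw [h]
        exact (hf m).trans (Nat.mul_le_mul (by omega) (Nat.pow_le_pow_left (by omega) _))
    · rw [show r + 1 + n * L = r + n * L + 1 by ring, h]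
      exact (hf' n).trans (Nat.mul_le_mul_right _ (by omega))

theorem add_one_pow_succ_le (n d : ℕ) :
    (n + 1) ^ (d + 1) ≤ n ^ (d + 1) + (d + 1) * (n + 1) ^ d := by
  induction d with
  | zero => simp
  | succ d ih =>
    have h : n ^ (d + 1) ≤ (n + 1) ^ (d + 1) := Nat.pow_le_pow_left (by omega) _
    calc (n + 1) ^ (d + 1 + 1) = (n + 1) ^ (d + 1) * (n + 1) := pow_succ _ _
      _ ≤ (n ^ (d + 1) + (d + 1) * (n + 1) ^ d) * (n + 1) := Nat.mul_le_mul_right _ ih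
      _ = n ^ (d + 1 + 1) + n ^ (d + 1) + (d + 1) * (n + 1) ^ (d + 1) := by ring
      _ ≤ n ^ (d + 1 + 1) + (d + 1 + 1) * (n + 1) ^ (d + 1) := by linarith

/-- Summation along the residue classes modulo `ℓ` preserves having an exact order. -/
theorem of_add_period {f g : ℕ → ℕ} {ℓ : ℕ} (hℓ : 0 < ℓ) (hf : HasExactOrder f)
    (h : ∀ m, g (m + ℓ) = g m + f m) : HasExactOrder g := by
  have hsmall (N m : ℕ) (hm : m < N) : g m ≤ ∑ i ∈ Finset.range N, g i :=
    Finset.single_le_sum (f := g) (fun _ _ => Nat.zero_le _) (Finset.mem_range.2 hm)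
  rcases hf with ⟨N, hf⟩ | ⟨d, C, r, L, hL, hf, hf'⟩
  · by_cases hz : ∀ m, N ≤ m → g m = 0
    · exact Or.inl ⟨N, hz⟩
    push Not at hz
    obtain ⟨r, hr, hgr⟩ := hz
    have hgr' : 1 ≤ g r := Nat.one_le_iff_ne_zero.2 hgr
    have hper (n : ℕ) : g (r + n * ℓ) = g r := by
      induction n with
      | zero => simp
      | succ n ih =>
        rw [show r + (n + 1) * ℓ = r + n * ℓ + ℓ by ring, h, ih, hf _ (by omega), add_zero]
    have hbd (m : ℕ) : g m ≤ ∑ i ∈ Finset.range (N + ℓ), g i := by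
      induction m using Nat.strong_induction_on with
      | _ m ih =>
        rcases lt_or_ge m (N + ℓ) with hm | hm
        · exact hsmall _ _ hm
        · obtain ⟨k, rfl⟩ := Nat.exists_eq_add_of_le' (show ℓ ≤ m by omega)
          rw [h, hf k (by omega), add_zero]
          exact ih k (by omega)
    refine Or.inr ⟨0, ∑ i ∈ Finset.range (N + ℓ), g i, r, ℓ, hℓ, fun m => by simpa using hbd m,
      fun n => ?_⟩
    rw [hper, pow_zero]
    exact Nat.mul_pos (hgr'.trans (hbd r)) hgr'
  · have hupper (m : ℕ) : g m ≤ (C + ∑ i ∈ Finset.range ℓ, g i) * (m + 1) ^ (d + 1) := by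
      induction m using Nat.strong_induction_on with
      | _ m ih =>
        rcases lt_or_ge m ℓ with hm | hm
        · exact (hsmall _ _ hm).trans ((Nat.le_add_left _ _).trans
            (Nat.le_mul_of_pos_right _ (by positivity)))
        · obtain ⟨k, rfl⟩ := Nat.exists_eq_add_of_le' hm
          rw [h]
          set D := C + ∑ i ∈ Finset.range ℓ, g i
          calc g k + f k ≤ D * (k + 1) ^ (d + 1) + D * (k + 1) ^ d :=
                add_le_add (ih k (by omega))
                  ((hf k).trans (Nat.mul_le_mul_right _ (Nat.le_add_right _ _)))
            _ = D * ((k + 1) ^ d * (k + 2)) := by ring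
            _ ≤ D * ((k + ℓ + 1) ^ d * (k + ℓ + 1)) :=
                Nat.mul_le_mul_left _ (Nat.mul_le_mul (Nat.pow_le_pow_left (by omega) _) (by omega))
            _ = D * (k + ℓ + 1) ^ (d + 1) := by ring
    have hmono (m k : ℕ) : g m ≤ g (m + k * ℓ) := by
      induction k with
      | zero => simp
      | succ k ih =>
        rw [show m + (k + 1) * ℓ = m + k * ℓ + ℓ by ring, h]
        omega
    have hstep (n : ℕ) : g (r + n * (L * ℓ)) + f (r + n * (L * ℓ)) ≤
        g (r + (n + 1) * (L * ℓ)) := by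
      obtain ⟨L, rfl⟩ := Nat.exists_eq_succ_of_ne_zero hL.ne'
      rw [← h]
      refine (hmono _ L).trans_eq (congrArg g ?_)
      simp only [Nat.succ_eq_add_one]
      ring
    have hlower (n : ℕ) : n ^ (d + 1) ≤ (d + 1) * C * g (r + n * (L * ℓ)) := by
      induction n with
      | zero => simp
      | succ n ih =>
        have h1 : (n + 1) ^ d ≤ C * f (r + n * (L * ℓ)) := by
          have := hf' (n * ℓ)
          rw [show n * ℓ * L = n * (L * ℓ) by ring] at this
          exact (Nat.pow_le_pow_left (by nlinarith) _).trans this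
        calc (n + 1) ^ (d + 1) ≤ n ^ (d + 1) + (d + 1) * (n + 1) ^ d := add_one_pow_succ_le n d
          _ ≤ (d + 1) * C * g (r + n * (L * ℓ)) + (d + 1) * (C * f (r + n * (L * ℓ))) := by
            gcongr
          _ = (d + 1) * C * (g (r + n * (L * ℓ)) + f (r + n * (L * ℓ))) := by ring
          _ ≤ (d + 1) * C * g (r + (n + 1) * (L * ℓ)) := Nat.mul_le_mul_left _ (hstep n)
    refine Or.inr ⟨d + 1, (C + ∑ i ∈ Finset.range ℓ, g i) + (d + 1) * C, r + L * ℓ, L * ℓ,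
      by positivity, fun m => (hupper m).trans (Nat.mul_le_mul_right _ (Nat.le_add_right _ _)),
      fun n => (hlower (n + 1)).trans ?_⟩
    rw [show r + L * ℓ + n * (L * ℓ) = r + (n + 1) * (L * ℓ) by ring]
    exact Nat.mul_le_mul_right _ (Nat.le_add_left _ _)

end HasExactOrder

namespace DFA

variable {α σ : Type*} (M : DFA α σ)

theorem evalFrom_flatten_replicate {q : σ} {w : List α} (hw : M.evalFrom q w = q) (n : ℕ) :
    M.evalFrom q (List.replicate n w).flatten = q := by
  induction n with
  | zero => simp
  | succ n ih => rw [List.replicate_succ, List.flatten_cons, evalFrom_of_append, hw, ih]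

variable [Fintype α]

/-- The words of length `m` over a finite alphabet. -/
noncomputable def wordsOfLength (α : Type*) [Fintype α] (m : ℕ) : Finset (List α) :=
  (List.finite_length_eq α m).toFinset

theorem mem_wordsOfLength {m : ℕ} {w : List α} : w ∈ wordsOfLength α m ↔ w.length = m := by
  simp [wordsOfLength]

open Classical in
theorem growthCount_eq_card (L : Language α) (m : ℕ) :
    L.growthCount m = ((wordsOfLength α m).filter (· ∈ L)).card := by
  rw [Language.growthCount, ← Set.ncard_coe_finset]
  congr 1
  ext w
  simp only [Set.mem_ofPred_eq, Finset.coe_filter, mem_wordsOfLength]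
  exact and_comm

/-- Sorting the accepted words by their prefix of length `k`. -/
theorem growthCount_acceptsFrom_add (q : σ) (m k : ℕ) :
    (M.acceptsFrom q).growthCount (m + k) =
      ∑ v ∈ wordsOfLength α k, (M.acceptsFrom (M.evalFrom q v)).growthCount m := by
  classical
  rw [growthCount_eq_card,
    Finset.card_eq_sum_card_fiberwise (f := List.take k) (t := wordsOfLength α k)]
  · refine Finset.sum_congr rfl fun v hv => ?_
    rw [mem_wordsOfLength] at hv
    rw [growthCount_eq_card]
    symm
    refine Finset.card_bij (fun w _ => v ++ w) ?_ (fun _ _ _ _ h => List.append_cancel_left h) ?_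
    · intro w hw
      simp only [Finset.mem_filter, mem_wordsOfLength, mem_acceptsFrom] at hw ⊢
      refine ⟨⟨by simp [hw.1, hv, add_comm], ?_⟩, by simp [← hv]⟩
      rw [evalFrom_of_append]
      exact hw.2
    · intro w hw
      simp only [Finset.mem_filter, mem_wordsOfLength, mem_acceptsFrom] at hw
      obtain ⟨⟨hlen, hacc⟩, rfl⟩ := hw
      refine ⟨w.drop k, ?_, List.take_append_drop k w⟩
      simp only [Finset.mem_filter, mem_wordsOfLength, mem_acceptsFrom]
      refine ⟨by simp [hlen], ?_⟩
      rwa [← evalFrom_of_append, List.take_append_drop]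
  · intro w hw
    simp only [Finset.coe_filter, Set.mem_ofPred_eq, mem_wordsOfLength] at hw
    simp only [Finset.mem_coe, mem_wordsOfLength, List.length_take]
    omega

/-- Under polynomial growth, a reachable state from which some word is accepted does not have two
distinct loops of the same length. -/
theorem loop_unique (hpoly : M.accepts.HasPolynomialGrowth) {x y u v : List α} {q : σ}
    (hx : M.eval x = q) (hy : y ∈ M.acceptsFrom q) (hu : M.evalFrom q u = q)
    (hv : M.evalFrom q v = q) (hlen : u.length = v.length) : u = v := by
  classical
  by_contra hne
  have hbase : 1 ≤ (M.acceptsFrom q).growthCount y.length := by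
    rw [growthCount_eq_card]
    exact Finset.card_pos.2 ⟨y, by simp [mem_wordsOfLength, hy]⟩
  have hdouble (m : ℕ) : 2 * (M.acceptsFrom q).growthCount m ≤
      (M.acceptsFrom q).growthCount (m + v.length) := by
    rw [growthCount_acceptsFrom_add]
    have hsub : {u, v} ⊆ wordsOfLength α v.length := by
      intro w hw
      simp only [Finset.mem_insert, Finset.mem_singleton] at hw
      rcases hw with rfl | rfl <;> simp [mem_wordsOfLength, hlen]
    refine le_trans ?_ (Finset.sum_le_sum_of_subset hsub)
    rw [Finset.sum_pair hne, hu, hv, two_mul]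
  have hpow (n : ℕ) :
      2 ^ n ≤ (M.acceptsFrom q).growthCount (y.length + n * v.length) := by
    induction n with
    | zero => simpa using hbase
    | succ n ih =>
      rw [show y.length + (n + 1) * v.length = y.length + n * v.length + v.length by ring,
        pow_succ']
      exact (Nat.mul_le_mul_left 2 ih).trans (hdouble _)
  obtain ⟨p, hp⟩ := hpoly
  obtain ⟨n, hn⟩ := p.exists_eval_lt_two_pow (x.length + y.length) v.length
  refine absurd (hp (x.length + y.length + n * v.length)) (not_le.2 (hn.trans_le ?_))
  rw [show x.length + y.length + n * v.length = y.length + n * v.length + x.length by ring]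
  refine (hpow n).trans ?_
  change _ ≤ (M.acceptsFrom M.start).growthCount _
  rw [growthCount_acceptsFrom_add M M.start]
  have := Finset.single_le_sum (s := wordsOfLength α x.length)
    (f := fun w => (M.acceptsFrom (M.evalFrom M.start w)).growthCount (y.length + n * v.length))
    (fun _ _ => Nat.zero_le _) (mem_wordsOfLength.2 rfl : x ∈ _)
  rwa [show M.evalFrom M.start x = q from hx] at this

/-- Under polynomial growth, a word leaving a loop never leads back to its base point. -/
theorem evalFrom_ne_of_ne_loop (hpoly : M.accepts.HasPolynomialGrowth) {x y w v : List α} {q : σ}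
    (hx : M.eval x = q) (hy : y ∈ M.acceptsFrom q) (hw : M.evalFrom q w = q) (hw0 : w ≠ [])
    (hlen : v.length = w.length) (hne : v ≠ w) (u : List α) :
    M.evalFrom (M.evalFrom q v) u ≠ q := by
  intro hu
  rw [← evalFrom_of_append] at hu
  obtain ⟨a, ha⟩ : ∃ a, w.length = a + 1 :=
    Nat.exists_eq_succ_of_ne_zero (by simpa using hw0)
  have hpos : (v ++ u).length = u.length + a + 1 := by
    simp only [List.length_append]
    omega
  have := M.loop_unique hpoly hx hy (M.evalFrom_flatten_replicate hu w.length)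
    (M.evalFrom_flatten_replicate hw (v ++ u).length) (by simp [mul_comm])
  rw [hpos, ha, List.replicate_succ, List.replicate_succ, List.flatten_cons, List.flatten_cons,
    List.append_assoc] at this
  exact hne (List.append_inj_left this hlen)

theorem hasExactOrder_growthCount_acceptsFrom [Finite σ]
    (hpoly : M.accepts.HasPolynomialGrowth) (x : List α) :
    HasExactOrder (M.acceptsFrom (M.eval x)).growthCount := by
  classical
  let reach (q : σ) : Set σ := Set.range (M.evalFrom q)
  induction hn : (reach (M.eval x)).ncard using Nat.strong_induction_on generalizing x with
  | _ n ih =>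
  set q := M.eval x with hq
  have hdesc (v : List α) (hv : ∀ u, M.evalFrom (M.evalFrom q v) u ≠ q) :
      HasExactOrder (M.acceptsFrom (M.evalFrom q v)).growthCount := by
    have hxv : M.evalFrom q v = M.eval (x ++ v) :=
      (M.evalFrom_of_append M.start x v).symm
    rw [hxv]
    refine ih _ ?_ (x ++ v) rfl
    rw [← hn, ← hxv]
    refine Set.ncard_lt_ncard ((Set.ssubset_iff_of_subset ?_).2 ⟨q, ⟨[], rfl⟩, ?_⟩)
    · rintro _ ⟨u, rfl⟩
      exact ⟨v ++ u, M.evalFrom_of_append _ _ _⟩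
    · rintro ⟨u, hu⟩
      exact hv u hu
  by_cases hacc : ∃ y, y ∈ M.acceptsFrom q
  swap
  · refine Or.inl ⟨0, fun m _ => ?_⟩
    rw [growthCount_eq_card, Finset.card_eq_zero, Finset.filter_eq_empty_iff]
    exact fun w _ hw => hacc ⟨w, hw⟩
  obtain ⟨y, hy⟩ := hacc
  by_cases hloop : ∃ w, w ≠ [] ∧ M.evalFrom q w = q
  · obtain ⟨w, hw0, hw⟩ := hloop
    have hs := HasExactOrder.sum ((wordsOfLength α w.length).erase w)
      (fun v => (M.acceptsFrom (M.evalFrom q v)).growthCount) fun v hv => by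
        rw [Finset.mem_erase, mem_wordsOfLength] at hv
        exact hdesc v (M.evalFrom_ne_of_ne_loop hpoly hq.symm hy hw hw0 hv.2 hv.1)
    refine hs.of_add_period (List.length_pos_iff.2 hw0) fun m => ?_
    rw [growthCount_acceptsFrom_add, Finset.sum_apply,
      ← Finset.add_sum_erase _ _ (mem_wordsOfLength.2 rfl : w ∈ _), hw]
  · push Not at hloop
    have hs := HasExactOrder.sum (wordsOfLength α 1)
      (fun v => (M.acceptsFrom (M.evalFrom q v)).growthCount) fun v hv => by
        rw [mem_wordsOfLength] at hv
        refine hdesc v fun u => ?_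
        rw [← evalFrom_of_append]
        refine hloop _ fun h => ?_
        simp_all
    refine hs.of_succ fun m => ?_
    rw [growthCount_acceptsFrom_add, Finset.sum_apply]

end DFA

/-- If `L(M)` is infinite and of polynomial growth for a DFA `M`, then there is a `d ≥ 1`
such that the growth of `L(M)` is `Θ(m^(d-1))`. -/
theorem exists_exact_order_of_polynomial_growth {α σ : Type*} [Fintype α] [Fintype σ]
    (M : DFA α σ) (hinf : (M.accepts : Set (List α)).Infinite)
    (hpoly : M.accepts.HasPolynomialGrowth) :
    ∃ d : ℕ, 1 ≤ d ∧ ∃ c₁ c₂ : ℝ, 0 < c₁ ∧ 0 < c₂ ∧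
      (∀ m : ℕ, 1 ≤ m → (M.accepts.growthCount m : ℝ) ≤ c₂ * (m : ℝ) ^ (d - 1)) ∧
      {m : ℕ | c₁ * (m : ℝ) ^ (d - 1) ≤ (M.accepts.growthCount m : ℝ)}.Infinite := by
  classical
  rcases M.hasExactOrder_growthCount_acceptsFrom hpoly [] with
    ⟨N, hN⟩ | ⟨d, C, r, L, hL, hupper, hlower⟩
  · refine absurd ((List.finite_length_lt α N).subset fun w hw => ?_) hinf
    by_contra hlen
    have h0 := hN w.length (not_lt.1 hlen)
    rw [DFA.growthCount_eq_card, Finset.card_eq_zero, Finset.filter_eq_empty_iff] at h0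
    exact h0 (DFA.mem_wordsOfLength.2 rfl) hw
  · change ∀ m, M.accepts.growthCount m ≤ _ at hupper
    change ∀ n, _ ≤ C * M.accepts.growthCount _ at hlower
    have hC : 0 < C := Nat.pos_of_ne_zero fun h => by simpa [h] using hlower 0
    have hD : 0 < (r + L) ^ d * C := by positivity
    refine ⟨d + 1, by omega, 1 / (((r + L) ^ d * C : ℕ) : ℝ), ((C * 2 ^ d : ℕ) : ℝ),
      by positivity, by positivity, fun m hm => ?_, ?_⟩
    · rw [Nat.add_sub_cancel]
      have : M.accepts.growthCount m ≤ C * 2 ^ d * m ^ d := by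
        refine (hupper m).trans ?_
        rw [mul_assoc, ← mul_pow]
        exact Nat.mul_le_mul_left _ (Nat.pow_le_pow_left (by omega) _)
      exact_mod_cast this
    · refine (Set.infinite_range_of_injective (f := fun n => r + n * L) fun a b hab => ?_).mono ?_
      · exact Nat.eq_of_mul_eq_mul_right hL (Nat.add_left_cancel hab)
      · rintro _ ⟨n, rfl⟩
        rw [Set.mem_ofPred_eq, Nat.add_sub_cancel, one_div_mul_eq_div,
          div_le_iff₀ (by exact_mod_cast hD)]
        have : (r + n * L) ^ d ≤ M.accepts.growthCount (r + n * L) * ((r + L) ^ d * C) := by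
          calc (r + n * L) ^ d ≤ ((r + L) * (n + 1)) ^ d :=
                Nat.pow_le_pow_left (by nlinarith) _
            _ = (r + L) ^ d * (n + 1) ^ d := mul_pow _ _ _
            _ ≤ (r + L) ^ d * (C * M.accepts.growthCount (r + n * L)) :=
                Nat.mul_le_mul_left _ (hlower n)
            _ = _ := by ring
        exact_mod_cast this
end
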